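/- Theorem (positive density of singular points): Fix an integer k ≥ 2 and a constant q with 0 < q < 1. Then there exists c > 0 such that P_{h,1−q}({S ⊆ R_h : the number of S-adjacent pairs (u,v) with det(u,v) ≥ k is greater than c times the total number of S-adjacent pairs}) → 1 as h → ∞. That is, with high probability the proportion δ_k of torus fixed points of singularity index at least k exceeds c. -/

import Mathlib

open Filter Topology

/-- A vector `u ∈ ℤ²` is primitive if it is nonzero and its coordinates are coprime. -/
def Primitive (u : ℤ × ℤ) : Prop := u ≠ 0 ∧ Int.gcd u.1 u.2 = 1

/-- The sup norm of a lattice vector, as a natural number. -/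
def hgt (u : ℤ × ℤ) : ℕ := max u.1.natAbs u.2.natAbs

/-- The determinant of the `2 × 2` matrix with columns `u` and `v`. -/
def det2 (u v : ℤ × ℤ) : ℤ := u.1 * v.2 - u.2 * v.1

/-- `w` lies in the open cone `{a·u + b·v : a, b ∈ ℝ, a > 0, b > 0}`. -/
def InOpenCone (u v w : ℤ × ℤ) : Prop :=
  ∃ a b : ℝ, 0 < a ∧ 0 < b ∧
    (w.1 : ℝ) = a * u.1 + b * v.1 ∧ (w.2 : ℝ) = a * u.2 + b * v.2

open Classical in
/-- The set of primitive vectors of sup norm at most `h` (the rays of the complete fan `Σ_h`). -/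
noncomputable def rays (h : ℕ) : Finset (ℤ × ℤ) :=
  (Finset.Icc (-(h : ℤ), -(h : ℤ)) ((h : ℤ), (h : ℤ))).filter (fun u => Primitive u)

/-- `u` and `v` are `S`-adjacent: both lie in `S`, `det(u,v) > 0`, and no element of `S`
lies in the open cone between them.  `S`-adjacent pairs span the 2-dimensional cones of
the completed fan of `S`. -/
def SAdj (S : Finset (ℤ × ℤ)) (u v : ℤ × ℤ) : Prop :=
  u ∈ S ∧ v ∈ S ∧ 0 < det2 u v ∧ ∀ w ∈ S, ¬ InOpenCone u v w

open Classical in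
/-- The probability, under the distribution `T(h, p)` (each ray of `Σ_h` kept
independently with probability `p`), of the set of fans whose ray set satisfies `A`. -/
noncomputable def prob (h : ℕ) (p : ℝ) (A : Finset (ℤ × ℤ) → Prop) : ℝ :=
  ∑ S ∈ (rays h).powerset,
    if A S then p ^ S.card * (1 - p) ^ ((rays h).card - S.card) else 0

open Classical in
/-- The `S`-adjacent pairs of `S`, corresponding to the torus fixed points of the
toric surface of the completed fan of `S`. -/
noncomputable def adjPairs (S : Finset (ℤ × ℤ)) : Finset ((ℤ × ℤ) × (ℤ × ℤ)) :=
  (S ×ˢ S).filter (fun p => SAdj S p.1 p.2)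

open Classical in
/-- The `S`-adjacent pairs with determinant (singularity index) at least `k`. -/
noncomputable def adjPairsGe (k : ℕ) (S : Finset (ℤ × ℤ)) : Finset ((ℤ × ℤ) × (ℤ × ℤ)) :=
  (S ×ˢ S).filter (fun p => SAdj S p.1 p.2 ∧ (k : ℤ) ≤ det2 p.1 p.2)

/-- The expectation of `f S` when each element of `R` is put into `S` independently with
probability `p`. -/
noncomputable def bernoulliExp (R : Finset (ℤ × ℤ)) (p : ℝ) (f : Finset (ℤ × ℤ) → ℝ) : ℝ :=
  ∑ S ∈ R.powerset, p ^ S.card * (1 - p) ^ (R.card - S.card) * f S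

theorem bernoulliExp_one (R : Finset (ℤ × ℤ)) (p : ℝ) : bernoulliExp R p (fun _ => 1) = 1 := by
  simp only [bernoulliExp, mul_one]
  rw [Finset.sum_pow_mul_eq_add_pow]
  simp

theorem bernoulliExp_union_mul {A B : Finset (ℤ × ℤ)} (hAB : Disjoint A B) (p : ℝ)
    (F G : Finset (ℤ × ℤ) → ℝ) :
    bernoulliExp (A ∪ B) p (fun S => F (S ∩ A) * G (S ∩ B)) =
      bernoulliExp A p F * bernoulliExp B p G := by
  classical
  unfold bernoulliExp
  rw [Finset.sum_mul_sum, ← Finset.sum_product']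
  refine Finset.sum_bij' (fun S _ => (S ∩ A, S ∩ B)) (fun P _ => P.1 ∪ P.2) ?_ ?_ ?_ ?_ ?_
  · intro S _
    simp [Finset.inter_subset_right]
  · rintro ⟨P, Q⟩ h
    simp only [Finset.mem_product, Finset.mem_powerset] at h ⊢
    exact Finset.union_subset_union h.1 h.2
  · intro S hS
    rw [← Finset.inter_union_distrib_left]
    exact Finset.inter_eq_left.2 (Finset.mem_powerset.1 hS)
  · rintro ⟨P, Q⟩ h
    simp only [Finset.mem_product, Finset.mem_powerset] at h
    have h1 : P ∩ B = ∅ := Finset.disjoint_iff_inter_eq_empty.1 (hAB.mono_left h.1)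
    have h2 : Q ∩ A = ∅ := Finset.disjoint_iff_inter_eq_empty.1 (hAB.symm.mono_left h.2)
    simp [Finset.union_inter_distrib_right, h1, h2, Finset.inter_eq_left.2 h.1,
      Finset.inter_eq_left.2 h.2]
  · intro S hS
    have hS' := Finset.mem_powerset.1 hS
    have hc : S.card = (S ∩ A).card + (S ∩ B).card := by
      rw [← Finset.card_union_of_disjoint
        (hAB.mono Finset.inter_subset_right Finset.inter_subset_right),
        ← Finset.inter_union_distrib_left, Finset.inter_eq_left.2 hS']
    have hA : (S ∩ A).card ≤ A.card := Finset.card_le_card Finset.inter_subset_right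
    have hB : (S ∩ B).card ≤ B.card := Finset.card_le_card Finset.inter_subset_right
    rw [Finset.card_union_of_disjoint hAB, hc,
      show A.card + B.card - ((S ∩ A).card + (S ∩ B).card) =
        (A.card - (S ∩ A).card) + (B.card - (S ∩ B).card) by omega, pow_add, pow_add]
    ring

/-- Functions of the traces of `S` on disjoint blocks are independent. -/
theorem bernoulliExp_prod {ι : Type*} [DecidableEq ι] (p : ℝ) (C : ι → Finset (ℤ × ℤ))
    (g : ι → Finset (ℤ × ℤ) → ℝ) (s : Finset ι)
    (hd : ∀ i ∈ s, ∀ j ∈ s, i ≠ j → Disjoint (C i) (C j)) :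
    ∀ R : Finset (ℤ × ℤ), (∀ i ∈ s, C i ⊆ R) →
      bernoulliExp R p (fun S => ∏ i ∈ s, g i (S ∩ C i)) = ∏ i ∈ s, bernoulliExp (C i) p (g i) := by
  induction s using Finset.induction_on with
  | empty => intro R _; simpa using bernoulliExp_one R p
  | insert a s ha ih =>
    intro R hR
    have hsub : ∀ i ∈ s, C i ⊆ R \ C a := fun i hi => by
      rw [Finset.subset_sdiff]
      refine ⟨hR i (Finset.mem_insert_of_mem hi), hd i (Finset.mem_insert_of_mem hi) a
        (Finset.mem_insert_self _ _) ?_⟩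
      rintro rfl
      exact ha hi
    rw [Finset.prod_insert ha, ← ih (fun i hi j hj => hd i (Finset.mem_insert_of_mem hi) j
      (Finset.mem_insert_of_mem hj)) (R \ C a) hsub,
      ← bernoulliExp_union_mul Finset.disjoint_sdiff,
      Finset.union_sdiff_of_subset (hR a (Finset.mem_insert_self _ _))]
    congr 1
    funext S
    rw [Finset.prod_insert ha]
    congr 1
    refine Finset.prod_congr rfl fun i hi => ?_
    rw [Finset.inter_assoc, Finset.inter_eq_right.2 (hsub i hi)]

theorem bernoulliExp_ite_eq {C T : Finset (ℤ × ℤ)} (hT : T ⊆ C) (p : ℝ) :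
    bernoulliExp C p (fun S => if S = T then (1 / 2 : ℝ) else 1) =
      1 - p ^ T.card * (1 - p) ^ (C.card - T.card) / 2 := by
  have hone := bernoulliExp_one C p
  simp only [bernoulliExp] at hone ⊢
  rw [← Finset.add_sum_erase _ _ (Finset.mem_powerset.2 hT)] at hone
  rw [eq_sub_iff_add_eq, ← Finset.add_sum_erase (C.powerset) _ (Finset.mem_powerset.2 hT), if_pos rfl,
    Finset.sum_congr rfl (g := fun S => p ^ S.card * (1 - p) ^ (C.card - S.card) * 1)]
  · linear_combination hone
  · intro S hS
    rw [if_neg (Finset.ne_of_mem_erase hS)]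

theorem bernoulliExp_mono {R : Finset (ℤ × ℤ)} {p : ℝ} (h0 : 0 ≤ p) (h1 : p ≤ 1)
    {f g : Finset (ℤ × ℤ) → ℝ} (hfg : ∀ S ⊆ R, f S ≤ g S) :
    bernoulliExp R p f ≤ bernoulliExp R p g :=
  Finset.sum_le_sum fun S hS => mul_le_mul_of_nonneg_left (hfg S (Finset.mem_powerset.1 hS))
    (mul_nonneg (pow_nonneg h0 _) (pow_nonneg (sub_nonneg.2 h1) _))

open Classical in
theorem prob_eq_bernoulliExp (h : ℕ) (p : ℝ) (A : Finset (ℤ × ℤ) → Prop) :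
    prob h p A = bernoulliExp (rays h) p (fun S => if A S then 1 else 0) := by
  simp [prob, bernoulliExp]

theorem prob_le_one (h : ℕ) {p : ℝ} (h0 : 0 ≤ p) (h1 : p ≤ 1) (A : Finset (ℤ × ℤ) → Prop) :
    prob h p A ≤ 1 := by
  classical
  rw [prob_eq_bernoulliExp]
  refine (bernoulliExp_mono h0 h1 fun S _ => ?_).trans_eq (bernoulliExp_one (rays h) p)
  split_ifs <;> norm_num

/-- A lower bound for the probability of `A`, when the failure of `A` is dominated by
a function `f`. -/
theorem one_sub_le_prob (h : ℕ) {p : ℝ} (h0 : 0 ≤ p) (h1 : p ≤ 1) (A : Finset (ℤ × ℤ) → Prop)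
    (f : Finset (ℤ × ℤ) → ℝ) (hf : ∀ S ⊆ rays h, 0 ≤ f S) (hA : ∀ S ⊆ rays h, ¬ A S → 1 ≤ f S) :
    1 - bernoulliExp (rays h) p f ≤ prob h p A := by
  classical
  rw [prob_eq_bernoulliExp, sub_le_iff_le_add]
  have := bernoulliExp_mono (R := rays h) h0 h1 (f := fun _ => 1)
    (g := fun S => (if A S then 1 else 0) + f S) (fun S hS => by
      by_cases hS' : A S
      · simpa [hS'] using hf S hS
      · simpa [hS'] using hA S hS hS')
  rw [bernoulliExp_one] at this
  refine this.trans_eq ?_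
  simp only [bernoulliExp, mul_add, Finset.sum_add_distrib]

theorem Primitive.eq_or_eq_neg {u v : ℤ × ℤ} (hu : Primitive u) (hv : Primitive v)
    (h : det2 u v = 0) : u = v ∨ u = -v := by
  obtain ⟨u1, u2⟩ := u
  obtain ⟨v1, v2⟩ := v
  have hu' : IsCoprime u1 u2 := Int.isCoprime_iff_gcd_eq_one.2 hu.2
  have hv' : IsCoprime v1 v2 := Int.isCoprime_iff_gcd_eq_one.2 hv.2
  obtain ⟨a, b, hab⟩ := hu'
  obtain ⟨c, d, hcd⟩ := hv'
  simp only [det2] at h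
  have e1 : v1 = (a * v1 + b * v2) * u1 := by linear_combination (-v1) * hab - b * h
  have e2 : v2 = (a * v1 + b * v2) * u2 := by linear_combination (-v2) * hab + a * h
  have hunit : (a * v1 + b * v2) * (c * u1 + d * u2) = 1 := by
    linear_combination hcd - c * e1 - d * e2
  rcases Int.isUnit_iff.1 (IsUnit.of_mul_eq_one _ hunit) with ht | ht <;> rw [ht] at e1 e2
  · left; ext <;> simp <;> linarith
  · right; ext <;> simp <;> linarith

theorem mem_rays {h : ℕ} {u : ℤ × ℤ} :
    u ∈ rays h ↔ (-(h : ℤ) ≤ u.1 ∧ u.1 ≤ h) ∧ (-(h : ℤ) ≤ u.2 ∧ u.2 ≤ h) ∧ Primitive u := by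
  simp only [rays, Finset.mem_filter, Finset.mem_Icc, Prod.le_def]
  tauto

theorem inOpenCone_of_det2_pos {u v w : ℤ × ℤ} (huv : 0 < det2 u v) (huw : 0 < det2 u w)
    (hwv : 0 < det2 w v) : InOpenCone u v w := by
  have huv' : (0 : ℝ) < det2 u v := by exact_mod_cast huv
  have huw' : (0 : ℝ) < det2 u w := by exact_mod_cast huw
  have hwv' : (0 : ℝ) < det2 w v := by exact_mod_cast hwv
  refine ⟨det2 w v / det2 u v, det2 u w / det2 u v, div_pos hwv' huv', div_pos huw' huv', ?_, ?_⟩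
  all_goals
    field_simp
    simp only [det2]
    push_cast
    ring

theorem card_adjPairs_le {h : ℕ} {S : Finset (ℤ × ℤ)} (hS : S ⊆ rays h) :
    (adjPairs S).card ≤ (rays h).card := by
  refine Finset.card_le_card_of_injOn Prod.fst ?_ ?_
  · rintro ⟨u, v⟩ hp
    simp only [adjPairs, Finset.coe_filter, Finset.mem_product, Set.mem_ofPred_eq] at hp
    exact hS hp.1.1
  · rintro ⟨u, v⟩ hp ⟨u', v'⟩ hp' hu
    simp only [adjPairs, Finset.coe_filter, Finset.mem_product, Set.mem_ofPred_eq] at hp hp' hu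
    subst hu
    obtain ⟨-, -, hv, hvd, hvc⟩ := hp
    obtain ⟨-, -, hv', hvd', hvc'⟩ := hp'
    rcases lt_trichotomy (det2 v v') 0 with hlt | heq | hgt
    · exact absurd (inOpenCone_of_det2_pos hvd hvd' (by simp only [det2] at *; linarith))
        (hvc v' hv')
    · rcases (mem_rays.1 (hS hv)).2.2.eq_or_eq_neg (mem_rays.1 (hS hv')).2.2 heq with e | e
      · rw [e]
      · rw [e] at hvd
        simp only [det2, Prod.fst_neg, Prod.snd_neg] at *
        linarith
    · exact absurd (inOpenCone_of_det2_pos hvd' hvd hgt) (hvc' v hv)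

/-- The rays of `Σ_h` in the open upper half plane. -/
noncomputable def upperRays (h : ℕ) : Finset (ℤ × ℤ) := (rays h).filter (fun u => 0 < u.2)

theorem mem_upperRays {h : ℕ} {u : ℤ × ℤ} : u ∈ upperRays h ↔ u ∈ rays h ∧ 0 < u.2 :=
  Finset.mem_filter

theorem Primitive.neg {u : ℤ × ℤ} (hu : Primitive u) : Primitive (-u) :=
  ⟨neg_ne_zero.2 hu.1, by simpa using hu.2⟩

theorem card_rays_le (h : ℕ) : (rays h).card ≤ 2 * (upperRays h).card + 2 := by
  have hsub : rays h ⊆ upperRays h ∪ (upperRays h).image (fun u => -u) ∪ {(1, 0), (-1, 0)} := by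
    intro u hu
    obtain ⟨h1, h2, hp⟩ := mem_rays.1 hu
    simp only [Finset.mem_union, Finset.mem_image, Finset.mem_insert, Finset.mem_singleton]
    rcases lt_trichotomy u.2 0 with hlt | heq | hgt
    · refine Or.inl (Or.inr ⟨-u, mem_upperRays.2 ⟨mem_rays.2 ⟨?_, ?_, hp.neg⟩, ?_⟩, neg_neg u⟩)
      · simp only [Prod.fst_neg]; omega
      · simp only [Prod.snd_neg]; omega
      · simp only [Prod.snd_neg]; omega
    · right
      have := hp.2
      rw [heq, Int.gcd_zero_right] at this
      rcases Int.natAbs_eq_iff.1 this with e | e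
      · left; ext <;> simp [e, heq]
      · right; ext <;> simp [e, heq]
    · exact Or.inl (Or.inl (mem_upperRays.2 ⟨hu, hgt⟩))
  calc (rays h).card ≤ _ := Finset.card_le_card hsub
    _ ≤ (upperRays h).card + (upperRays h).card + 2 := by
        refine (Finset.card_union_le _ _).trans (add_le_add ?_ Finset.card_le_two)
        exact (Finset.card_union_le _ _).trans (add_le_add le_rfl Finset.card_image_le)
    _ = _ := by ring

theorem le_card_upperRays (h : ℕ) : h ≤ (upperRays h).card := by
  calc h = (Finset.range h).card := (Finset.card_range h).symm
    _ ≤ _ := Finset.card_le_card_of_injOn (fun a : ℕ => ((a : ℤ), (1 : ℤ))) ?_ ?_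
  · intro a ha
    have ha' := Finset.mem_range.1 (Finset.mem_coe.1 ha)
    refine Finset.mem_coe.2 (mem_upperRays.2 ⟨mem_rays.2 ⟨?_, ?_, ?_, ?_⟩, ?_⟩)
    · dsimp only; omega
    · dsimp only; omega
    · simp [Prod.ext_iff]
    · simp
    · norm_num
  · intro a _ b _ hab
    simpa using hab

theorem det2_pos_trans {u v w : ℤ × ℤ} (hu : 0 < u.2) (hv : 0 < v.2) (hw : 0 < w.2)
    (huv : 0 < det2 u v) (hvw : 0 < det2 v w) : 0 < det2 u w := by
  have e : v.2 * det2 u w = u.2 * det2 v w + w.2 * det2 u v := by simp only [det2]; ring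
  have : 0 < v.2 * det2 u w := by rw [e]; positivity
  exact pos_of_mul_pos_right this hv.le

theorem eq_of_mem_upperRays {h : ℕ} {u v : ℤ × ℤ} (hu : u ∈ upperRays h) (hv : v ∈ upperRays h)
    (huv : det2 u v = 0) : u = v := by
  rw [mem_upperRays] at hu hv
  rcases (mem_rays.1 hu.1).2.2.eq_or_eq_neg (mem_rays.1 hv.1).2.2 huv with e | e
  · exact e
  · have := hu.2
    rw [e, Prod.snd_neg] at this
    linarith [hv.2]

/-- The number of upper rays preceding `u` in the counterclockwise order. -/
noncomputable def rayRank (h : ℕ) (u : ℤ × ℤ) : ℕ :=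
  ((upperRays h).filter (fun w => 0 < det2 w u)).card

theorem rayRank_lt {h : ℕ} {u v : ℤ × ℤ} (hu : u ∈ upperRays h) (hv : v ∈ upperRays h)
    (huv : 0 < det2 u v) : rayRank h u < rayRank h v := by
  refine Finset.card_lt_card (Finset.ssubset_iff_of_subset ?_ |>.2 ⟨u, ?_, ?_⟩)
  · intro w hw
    rw [Finset.mem_filter] at hw ⊢
    exact ⟨hw.1, det2_pos_trans (mem_upperRays.1 hw.1).2 (mem_upperRays.1 hu).2
      (mem_upperRays.1 hv).2 hw.2 huv⟩
  · exact Finset.mem_filter.2 ⟨hu, huv⟩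
  · simp [det2, mul_comm]

theorem rayRank_injOn (h : ℕ) : Set.InjOn (rayRank h) (upperRays h) := by
  intro u hu v hv huv
  rcases lt_trichotomy (det2 u v) 0 with hlt | heq | hgt
  · exact absurd huv (rayRank_lt hv hu (by simp only [det2] at *; linarith)).ne'
  · exact eq_of_mem_upperRays hu hv heq
  · exact absurd huv (rayRank_lt hu hv hgt).ne

theorem image_rayRank (h : ℕ) :
    (upperRays h).image (rayRank h) = Finset.range (upperRays h).card := by
  refine Finset.eq_of_subset_of_card_le ?_ ?_
  · intro n hn
    obtain ⟨u, hu, rfl⟩ := Finset.mem_image.1 hn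
    refine Finset.mem_range.2 (Finset.card_lt_card (Finset.ssubset_iff_of_subset
      (Finset.filter_subset _ _) |>.2 ⟨u, hu, ?_⟩))
    simp [det2, mul_comm]
  · rw [Finset.card_image_of_injOn (rayRank_injOn h), Finset.card_range]

/-- The `b`-th block of `B` consecutive upper rays. -/
noncomputable def rayBlock (h B b : ℕ) : Finset (ℤ × ℤ) :=
  (upperRays h).filter (fun u => rayRank h u / B = b)

theorem mem_rayBlock {h B b : ℕ} {u : ℤ × ℤ} :
    u ∈ rayBlock h B b ↔ u ∈ upperRays h ∧ rayRank h u / B = b := Finset.mem_filter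

theorem rayBlock_subset (h B b : ℕ) : rayBlock h B b ⊆ rays h :=
  (Finset.filter_subset _ _).trans (Finset.filter_subset _ _)

theorem disjoint_rayBlock (h B : ℕ) {b b' : ℕ} (hb : b ≠ b') :
    Disjoint (rayBlock h B b) (rayBlock h B b') := by
  rw [Finset.disjoint_left]
  intro u hu hu'
  exact hb ((mem_rayBlock.1 hu).2.symm.trans (mem_rayBlock.1 hu').2)

theorem card_rayBlock {h B b : ℕ} (hB : 0 < B) (hb : b < (upperRays h).card / B) :
    (rayBlock h B b).card = B := by
  have hinj : Set.InjOn (rayRank h) (rayBlock h B b) :=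
    (rayRank_injOn h).mono (Finset.coe_subset.2 (Finset.filter_subset _ _))
  rw [← Finset.card_image_of_injOn hinj]
  have : (rayBlock h B b).image (rayRank h) = Finset.Ico (b * B) (b * B + B) := by
    ext n
    simp only [Finset.mem_image, mem_rayBlock, Finset.mem_Ico]
    constructor
    · rintro ⟨u, ⟨-, hu⟩, rfl⟩
      rw [Nat.div_eq_iff hB] at hu
      omega
    · rintro ⟨h1, h2⟩
      have hn : n < (upperRays h).card := by
        have h3 : (b + 1) * B ≤ (upperRays h).card := (Nat.le_div_iff_mul_le hB).1 hb
        rw [add_mul, one_mul] at h3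
        omega
      rw [← Finset.mem_range, ← image_rayRank, Finset.mem_image] at hn
      obtain ⟨u, hu, rfl⟩ := hn
      refine ⟨u, ⟨hu, ?_⟩, rfl⟩
      rw [Nat.div_eq_iff hB]
      omega
  rw [this, Nat.card_Ico, Nat.add_sub_cancel_left]

/-- Among sufficiently many upper rays, two span a large determinant. -/
theorem exists_le_det2 {h k : ℕ} (hk : 0 < k) {C : Finset (ℤ × ℤ)} (hC : C ⊆ upperRays h)
    (hcard : 4 * k ^ 2 < C.card) : ∃ u ∈ C, ∃ v ∈ C, (k : ℤ) ≤ det2 u v := by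
  by_contra! hlt
  obtain ⟨x, hx, y, hy, hxy⟩ := Finset.one_lt_card.1 (lt_of_le_of_lt (by nlinarith) hcard)
  have hdet : det2 x y ≠ 0 := fun e => hxy (eq_of_mem_upperRays (hC hx) (hC hy) e)
  have hle : C.card ≤ (Finset.Ioo (-(k : ℤ)) k ×ˢ Finset.Ioo (-(k : ℤ)) k).card := by
    refine Finset.card_le_card_of_injOn (fun w => (det2 x w, det2 y w)) ?_ ?_
    · intro w hw
      have hw := Finset.mem_coe.1 hw
      have hsymm : ∀ a b, det2 a b = - det2 b a := fun a b => by simp only [det2]; ring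
      have := hlt x hx w hw
      have := hlt y hy w hw
      have := hlt w hw x hx
      have := hlt w hw y hy
      have := hsymm x w
      have := hsymm y w
      simp only [Finset.coe_product, Set.mem_prod, Finset.coe_Ioo, Set.mem_Ioo]
      omega
    · intro w _ w' _ hww
      simp only [Prod.mk.injEq] at hww
      obtain ⟨e1, e2⟩ := hww
      simp only [det2] at e1 e2 hdet
      ext
      · refine mul_left_cancel₀ hdet ?_
        linear_combination y.1 * e1 - x.1 * e2
      · refine mul_left_cancel₀ hdet ?_
        linear_combination y.2 * e1 - x.2 * e2
  rw [Finset.card_product, Int.card_Ioo] at hle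
  have h2 : ((k : ℤ) - -(k : ℤ) - 1).toNat ≤ 2 * k := by omega
  have := Nat.mul_le_mul h2 h2
  nlinarith

/-- A pair isolated in a block of consecutive rays is adjacent. -/
theorem sAdj_of_inter_rayBlock {h B b : ℕ} {S : Finset (ℤ × ℤ)} (hS : S ⊆ rays h) {u v : ℤ × ℤ}
    (huv : 0 < det2 u v) (hI : S ∩ rayBlock h B b = {u, v}) : SAdj S u v := by
  have hu : u ∈ S ∩ rayBlock h B b := by rw [hI]; simp
  have hv : v ∈ S ∩ rayBlock h B b := by rw [hI]; simp
  rw [Finset.mem_inter, mem_rayBlock] at hu hv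
  refine ⟨hu.1, hv.1, huv, ?_⟩
  rintro w hw ⟨x, y, hx, hy, e1, e2⟩
  have hu2 : (0 : ℝ) < u.2 := by exact_mod_cast (mem_upperRays.1 hu.2.1).2
  have hv2 : (0 : ℝ) < v.2 := by exact_mod_cast (mem_upperRays.1 hv.2.1).2
  have hw2 : (0 : ℝ) < w.2 := by rw [e2]; positivity
  have hwU : w ∈ upperRays h := mem_upperRays.2 ⟨hS hw, by exact_mod_cast hw2⟩
  have huv' : (0 : ℝ) < det2 u v := by exact_mod_cast huv
  have d1 : (det2 u w : ℝ) = y * det2 u v := by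
    simp only [det2]; push_cast; rw [e1, e2]; ring
  have d2 : (det2 w v : ℝ) = x * det2 u v := by
    simp only [det2]; push_cast; rw [e1, e2]; ring
  have huw : 0 < det2 u w := by
    have : (0 : ℝ) < det2 u w := by rw [d1]; positivity
    exact_mod_cast this
  have hwv : 0 < det2 w v := by
    have : (0 : ℝ) < det2 w v := by rw [d2]; positivity
    exact_mod_cast this
  have r1 := rayRank_lt hu.2.1 hwU huw
  have r2 := rayRank_lt hwU hv.2.1 hwv
  have hwB : w ∈ rayBlock h B b := mem_rayBlock.2 ⟨hwU, le_antisymm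
    (hv.2.2 ▸ Nat.div_le_div_right r2.le) (hu.2.2 ▸ Nat.div_le_div_right r1.le)⟩
  have hwI : w ∈ S ∩ rayBlock h B b := Finset.mem_inter.2 ⟨hw, hwB⟩
  rw [hI, Finset.mem_insert, Finset.mem_singleton] at hwI
  rcases hwI with rfl | rfl
  · exact r1.false
  · exact r2.false

/-- The number of blocks meeting `S` in a prescribed pair of large determinant is a lower bound
for the number of adjacent pairs of large determinant. -/
theorem card_filter_le_card_adjPairsGe {h B M k : ℕ} (hk : 0 < k) {S : Finset (ℤ × ℤ)}
    (hS : S ⊆ rays h) {u v : ℕ → ℤ × ℤ} (huv : ∀ b < M, (k : ℤ) ≤ det2 (u b) (v b)) :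
    ((Finset.range M).filter (fun b => S ∩ rayBlock h B b = {u b, v b})).card ≤
      (adjPairsGe k S).card := by
  refine Finset.card_le_card_of_injOn (fun b => (u b, v b)) ?_ ?_
  · intro b hb
    rw [Finset.mem_coe, Finset.mem_filter, Finset.mem_range] at hb
    have hadj := sAdj_of_inter_rayBlock hS
      (lt_of_lt_of_le (by exact_mod_cast hk) (huv b hb.1)) hb.2
    simp only [adjPairsGe, Finset.mem_coe, Finset.mem_filter, Finset.mem_product]
    exact ⟨⟨hadj.1, hadj.2.1⟩, hadj, huv b hb.1⟩
  · intro b hb b' hb' hbb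
    rw [Finset.mem_coe, Finset.mem_filter] at hb hb'
    have h1 : u b ∈ S ∩ rayBlock h B b := by rw [hb.2]; simp
    have h2 : u b' ∈ S ∩ rayBlock h B b' := by rw [hb'.2]; simp
    rw [Finset.mem_inter, mem_rayBlock] at h1 h2
    rw [← h1.2.2, ← h2.2.2, (Prod.mk.inj hbb).1]

/-- Exponential lower tail: with overwhelming probability a positive proportion of the blocks
contributes an adjacent pair of large determinant. -/
theorem one_sub_pow_le_prob {k : ℕ} (hk : 0 < k) {p : ℝ} (h0 : 0 ≤ p) (h1 : p ≤ 1) {B : ℕ}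
    (hB : 4 * k ^ 2 < B) {c : ℝ} (h : ℕ) :
    1 - (2 ^ c * (1 - p ^ 2 * (1 - p) ^ (B - 2) / 2)) ^ ((upperRays h).card / B) ≤
      prob h p (fun S => c * ((upperRays h).card / B : ℕ) < (adjPairsGe k S).card) := by
  classical
  set M := (upperRays h).card / B with hM
  have hB0 : 0 < B := by omega
  have hex : ∀ b, ∃ P : (ℤ × ℤ) × (ℤ × ℤ), b < M →
      P.1 ∈ rayBlock h B b ∧ P.2 ∈ rayBlock h B b ∧ (k : ℤ) ≤ det2 P.1 P.2 := by
    intro b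
    by_cases hb : b < M
    · obtain ⟨u, hu, v, hv, huv⟩ := exists_le_det2 (C := rayBlock h B b) hk
        (Finset.filter_subset _ _) (by rwa [card_rayBlock hB0 hb])
      exact ⟨(u, v), fun _ => ⟨hu, hv, huv⟩⟩
    · exact ⟨0, fun hb' => absurd hb' hb⟩
  choose P hP using hex
  let T : ℕ → Finset (ℤ × ℤ) := fun b => {(P b).1, (P b).2}
  let f : Finset (ℤ × ℤ) → ℝ := fun S =>
    ∏ b ∈ Finset.range M, if S ∩ rayBlock h B b = T b then (1 / 2 : ℝ) else 1
  have hf : ∀ S, f S = (1 / 2 : ℝ) ^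
      ((Finset.range M).filter (fun b => S ∩ rayBlock h B b = T b)).card := by
    intro S
    simp only [f]
    rw [Finset.prod_ite]
    simp
  have hE : bernoulliExp (rays h) p f = (1 - p ^ 2 * (1 - p) ^ (B - 2) / 2) ^ M := by
    simp only [f]
    rw [bernoulliExp_prod p (rayBlock h B)
      (fun b S => if S = T b then (1 / 2 : ℝ) else 1) (Finset.range M)
      (fun i _ j _ hij => disjoint_rayBlock h B hij) (rays h)
      (fun i _ => rayBlock_subset h B i)]
    rw [Finset.prod_congr rfl (g := fun _ => 1 - p ^ 2 * (1 - p) ^ (B - 2) / 2)]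
    · simp
    · intro b hb
      have hbM := Finset.mem_range.1 hb
      obtain ⟨hu, hv, huv⟩ := hP b hbM
      have hne : (P b).1 ≠ (P b).2 := by
        intro e
        rw [e] at huv
        simp only [det2, mul_comm, sub_self] at huv
        omega
      rw [bernoulliExp_ite_eq (by simp [T, Finset.insert_subset_iff, hu, hv]),
        card_rayBlock hB0 hbM, Finset.card_pair hne]
  have hscale : bernoulliExp (rays h) p (fun S => ((2 : ℝ) ^ c) ^ M * f S) =
      (2 ^ c * (1 - p ^ 2 * (1 - p) ^ (B - 2) / 2)) ^ M := by
    rw [mul_pow, ← hE]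
    simp only [bernoulliExp, Finset.mul_sum]
    exact Finset.sum_congr rfl fun _ _ => by ring
  rw [← hscale]
  refine one_sub_le_prob h h0 h1 _ _ (fun S _ => ?_) (fun S hS hA => ?_)
  · rw [hf]; positivity
  · rw [hf, ← Real.rpow_natCast (2 ^ c), ← Real.rpow_mul (by norm_num), one_div, inv_pow,
      ← div_eq_mul_inv, one_le_div (by positivity), ← Real.rpow_natCast]
    refine Real.rpow_le_rpow_of_exponent_le (by norm_num) ?_
    refine le_trans ?_ (not_lt.1 hA)
    exact_mod_cast card_filter_le_card_adjPairsGe hk hS (fun b hb => (hP b hb).2.2)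

theorem prob_mono (h : ℕ) {p : ℝ} (h0 : 0 ≤ p) (h1 : p ≤ 1) {A A' : Finset (ℤ × ℤ) → Prop}
    (hA : ∀ S ⊆ rays h, A S → A' S) : prob h p A ≤ prob h p A' := by
  classical
  rw [prob_eq_bernoulliExp, prob_eq_bernoulliExp]
  refine bernoulliExp_mono h0 h1 fun S hS => ?_
  by_cases hAS : A S
  · simp [hAS, hA S hS hAS]
  · rw [if_neg hAS]
    split_ifs <;> norm_num

/-- Positive density of singular points: for fixed `k ≥ 2` and `0 < q < 1`, there is
`c > 0` such that with high probability the proportion of torus fixed points of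
singularity index at least `k` exceeds `c`. -/
theorem singular_density (k : ℕ) (hk : 2 ≤ k) (q : ℝ) (hq0 : 0 < q) (hq1 : q < 1) :
    ∃ c : ℝ, 0 < c ∧
      Tendsto (fun h : ℕ =>
          prob h (1 - q) (fun S =>
            c * ((adjPairs S).card : ℝ) < ((adjPairsGe k S).card : ℝ)))
        atTop (nhds 1) := by
  have hk0 : 0 < k := by omega
  have hp0 : 0 < 1 - q := by linarith
  have hp1 : 1 - q ≤ 1 := by linarith
  obtain ⟨B, hB⟩ : ∃ B, 4 * k ^ 2 < B := ⟨_, Nat.lt_succ_self _⟩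
  have hB0 : 0 < B := by omega
  set r : ℝ := 1 - (1 - q) ^ 2 * (1 - (1 - q)) ^ (B - 2) / 2 with hr
  have hr1 : r < 1 := by
    have : 0 < (1 - q) ^ 2 * (1 - (1 - q)) ^ (B - 2) :=
      mul_pos (pow_pos hp0 _) (pow_pos (by linarith) _)
    linarith
  have hr0 : 0 < r := by
    have : (1 - q) ^ 2 * (1 - (1 - q)) ^ (B - 2) ≤ 1 :=
      mul_le_one₀ (pow_le_one₀ hp0.le hp1) (pow_nonneg (by linarith) _)
        (pow_le_one₀ (by linarith) (by linarith))
    linarith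
  have hy1 : 1 < 2 / (1 + r) := by rw [lt_div_iff₀ (by linarith)]; linarith
  set d : ℝ := Real.logb 2 (2 / (1 + r)) with hd
  have hd0 : 0 < d := Real.logb_pos (by norm_num) hy1
  have hdr : 2 ^ d * r < 1 := by
    rw [hd, Real.rpow_logb (by norm_num) (by norm_num) (by linarith), div_mul_eq_mul_div,
      div_lt_one (by linarith)]
    linarith
  have hdr0 : 0 ≤ (2 : ℝ) ^ d * r := by positivity
  refine ⟨d / (4 * B + 2), by positivity, ?_⟩
  have hMtop : Tendsto (fun h => (upperRays h).card / B) atTop atTop :=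
    (Nat.tendsto_div_const_atTop hB0.ne').comp (tendsto_atTop_mono le_card_upperRays tendsto_id)
  have hlow : Tendsto (fun h => 1 - (2 ^ d * r) ^ ((upperRays h).card / B)) atTop (nhds 1) := by
    simpa using ((tendsto_pow_atTop_nhds_zero_of_lt_one hdr0 hdr).comp hMtop).const_sub 1
  refine tendsto_of_tendsto_of_tendsto_of_le_of_le' hlow tendsto_const_nhds ?_
    (Eventually.of_forall fun h => prob_le_one h hp0.le hp1 _)
  filter_upwards [hMtop.eventually_ge_atTop 1] with h hM
  refine (one_sub_pow_le_prob hk0 hp0.le hp1 hB h).trans (prob_mono h hp0.le hp1 ?_)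
  intro S hS hlt
  refine lt_of_le_of_lt ?_ hlt
  set M := (upperRays h).card / B with hMdef
  have hn : (upperRays h).card < B * (M + 1) := by
    rw [hMdef]; exact Nat.lt_mul_div_succ _ hB0
  have hcard : (adjPairs S).card ≤ (4 * B + 2) * M := by
    have h1 := card_adjPairs_le hS
    have h2 := card_rays_le h
    nlinarith
  have hcard' : ((adjPairs S).card : ℝ) ≤ (4 * B + 2) * M := by exact_mod_cast hcard
  calc d / (4 * B + 2) * ((adjPairs S).card : ℝ) ≤ d / (4 * B + 2) * ((4 * B + 2) * M) := by
        gcongr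
    _ = d * M := by field_simp
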